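/- arXiv:1711.05796 — 5 statements merged into one kernel-verified Lean document; each statement's English description precedes it below -/
import Mathlib

section
/- There exist matrices n₁, …, n₁₈ ∈ M₃(ℂ) such that for every A ∈ M₃(ℂ), tr(A³) = ∑_{i=1}^{18} (tr(nᵢA))³. In particular, the symmetrized 3×3 matrix multiplication tensor sM₍₃₎ has Waring (symmetric) rank at most 18. -/
/-- The cubes of the discrete Fourier transform of `(x, y, z)` over `ℤ/3` sum to
`3 (x³ + y³ + z³) + 18 x y z`. -/
theorem sum_cubes_fourier_three {R : Type*} [CommRing R] {w : R} (hw : w ^ 2 + w + 1 = 0)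
    (x y z : R) :
    (x + y + z) ^ 3 + (x + w * y + w ^ 2 * z) ^ 3 + (x + w ^ 2 * y + w * z) ^ 3 =
      3 * (x ^ 3 + y ^ 3 + z ^ 3) + 18 * (x * y * z) := by
  grind

/-- The cube of the linear form given by a scaled `3 × 3` matrix, in coordinates. -/
theorem trace_smul_mul_pow_three_fin_three {R : Type*} [CommRing R]
    (c a₀₀ a₀₁ a₀₂ a₁₀ a₁₁ a₁₂ a₂₀ a₂₁ a₂₂ : R) (A : Matrix (Fin 3) (Fin 3) R) :
    Matrix.trace ((c • !![a₀₀, a₀₁, a₀₂; a₁₀, a₁₁, a₁₂; a₂₀, a₂₁, a₂₂]) * A) ^ 3 =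
      c ^ 3 * (a₀₀ * A 0 0 + a₀₁ * A 1 0 + a₀₂ * A 2 0 + a₁₀ * A 0 1 + a₁₁ * A 1 1 +
        a₁₂ * A 2 1 + a₂₀ * A 0 2 + a₂₁ * A 1 2 + a₂₂ * A 2 2) ^ 3 := by
  rw [Matrix.smul_mul, Matrix.trace_smul, smul_eq_mul, mul_pow]
  congr 2
  simp [Matrix.trace_fin_three, Matrix.vecMul, Matrix.vecHead, Matrix.vecTail]
  ring

/-- The trace of the cube of a `3 × 3` matrix, in coordinates. -/
theorem trace_pow_three_fin_three {R : Type*} [CommRing R] (A : Matrix (Fin 3) (Fin 3) R) :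
    Matrix.trace (A ^ 3) = A 0 0 ^ 3 + A 1 1 ^ 3 + A 2 2 ^ 3 +
      3 * (A 0 0 + A 1 1) * (A 0 1 * A 1 0) + 3 * (A 1 1 + A 2 2) * (A 1 2 * A 2 1) +
      3 * (A 2 2 + A 0 0) * (A 2 0 * A 0 2) +
      3 * (A 0 1 * A 1 2 * A 2 0) + 3 * (A 1 0 * A 2 1 * A 0 2) := by
  rw [pow_succ, pow_two]
  simp only [Matrix.trace_fin_three, Matrix.mul_apply, Fin.sum_univ_three]
  ring

/-- There exist 18 matrices n₁, …, n₁₈ ∈ M₃(ℂ) such that tr(A³) = ∑ᵢ (tr(nᵢA))³ for all A: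
the symmetrized 3×3 matrix multiplication tensor has Waring rank at most 18. -/
theorem waring_rank_sM3_le_18 :
    ∃ n : Fin 18 → Matrix (Fin 3) (Fin 3) ℂ,
      ∀ A : Matrix (Fin 3) (Fin 3) ℂ,
        Matrix.trace (A ^ 3) = ∑ i : Fin 18, (Matrix.trace (n i * A)) ^ 3 := by
  obtain ⟨w, hw⟩ : ∃ w : ℂ, w ^ 2 + w + 1 = 0 := by
    have h := (Complex.isPrimitiveRoot_exp 3 (by norm_num)).geom_sum_eq_zero (by norm_num)
    simp only [Finset.sum_range_succ, Finset.sum_range_zero, pow_zero, pow_one] at h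
    exact ⟨_, by linear_combination h⟩
  obtain ⟨c, hc⟩ := IsAlgClosed.exists_pow_nat_eq (1 / 6 : ℂ) (n := 3) (by norm_num)
  obtain ⟨d, hd⟩ := IsAlgClosed.exists_pow_nat_eq (-1 / 3 : ℂ) (n := 3) (by norm_num)
  -- The first nine matrices are multiples of the Weyl operators; the others are multiples of
  -- the projections onto the lines spanned by the vectors `e j - w ^ k e (j + 1)`.
  refine ⟨![
    d • !![1, 0, 0; 0, 1, 0; 0, 0, 1],
    c • !![1, 0, 0; 0, w, 0; 0, 0, w ^ 2],
    c • !![1, 0, 0; 0, w ^ 2, 0; 0, 0, w],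
    c • !![0, 0, 1; 1, 0, 0; 0, 1, 0],
    c • !![0, 0, w ^ 2; 1, 0, 0; 0, w, 0],
    c • !![0, 0, w; 1, 0, 0; 0, w ^ 2, 0],
    c • !![0, 1, 0; 0, 0, 1; 1, 0, 0],
    c • !![0, 1, 0; 0, 0, w; w ^ 2, 0, 0],
    c • !![0, 1, 0; 0, 0, w ^ 2; w, 0, 0],
    c • !![1, -1, 0; -1, 1, 0; 0, 0, 0],
    c • !![1, -(w ^ 2), 0; -w, 1, 0; 0, 0, 0],
    c • !![1, -w, 0; -(w ^ 2), 1, 0; 0, 0, 0],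
    c • !![0, 0, 0; 0, 1, -1; 0, -1, 1],
    c • !![0, 0, 0; 0, 1, -(w ^ 2); 0, -w, 1],
    c • !![0, 0, 0; 0, 1, -w; 0, -(w ^ 2), 1],
    c • !![1, 0, -1; 0, 0, 0; -1, 0, 1],
    c • !![1, 0, -w; 0, 0, 0; -(w ^ 2), 0, 1],
    c • !![1, 0, -(w ^ 2); 0, 0, 0; -w, 0, 1]], fun A => ?_⟩
  have hdiag := sum_cubes_fourier_three hw (A 0 0) (A 1 1) (A 2 2)
  have hup := sum_cubes_fourier_three hw (A 0 1) (A 1 2) (A 2 0)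
  have hdown := sum_cubes_fourier_three hw (A 1 0) (A 2 1) (A 0 2)
  have h01 := sum_cubes_fourier_three hw (A 0 0 + A 1 1) (-A 0 1) (-A 1 0)
  have h12 := sum_cubes_fourier_three hw (A 1 1 + A 2 2) (-A 1 2) (-A 2 1)
  have h20 := sum_cubes_fourier_three hw (A 2 2 + A 0 0) (-A 2 0) (-A 0 2)
  rw [trace_pow_three_fin_three]
  simp only [Fin.sum_univ_succ, Fin.sum_univ_zero, Matrix.cons_val_zero, Matrix.cons_val_succ,
    trace_smul_mul_pow_three_fin_three, hc, hd]
  linear_combination (-1 / 6 : ℂ) * (hdiag + hup + hdown + h01 + h12 + h20)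
end

section
/- For each i ∈ {1,…,18} there exist j ∈ {1,…,18} and k ∈ {0,1,2} such that the entrywise complex conjugate of mᵢ equals ζᵏ·mⱼ. (Hence the Waring decomposition is closed under complex conjugation, a Galois symmetry.) -/
open Matrix

noncomputable def ζ : ℂ := Complex.exp (2 * Real.pi * Complex.I / 3)

noncomputable def a : ℂ := (((-((2 : ℝ) ^ (-(1/3 : ℝ)))) : ℝ) : ℂ)

noncomputable def m : Fin 18 → Matrix (Fin 3) (Fin 3) ℂ :=
  ![!![1, -1, 0; -1, 1, 0; 0, 0, 0],
    !![0, 0, 0; 0, 1, -ζ; 0, -ζ^2, 1],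
    !![1, 0, -ζ; 0, 0, 0; -ζ^2, 0, 1],
    !![0, 0, 0; 0, 1, -ζ^2; 0, -ζ, 1],
    !![1, 0, -1; 0, 0, 0; -1, 0, 1],
    !![1, -ζ, 0; -ζ^2, 1, 0; 0, 0, 0],
    !![1, 0, -ζ^2; 0, 0, 0; -ζ, 0, 1],
    !![1, -ζ^2, 0; -ζ, 1, 0; 0, 0, 0],
    !![0, 0, 0; 0, 1, -1; 0, -1, 1],
    a • (1 : Matrix (Fin 3) (Fin 3) ℂ),
    !![0, 1, 0; 0, 0, ζ; ζ^2, 0, 0],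
    !![0, 0, 1; ζ^2, 0, 0; 0, ζ, 0],
    !![0, 1, 0; 0, 0, ζ^2; ζ, 0, 0],
    !![0, 0, 1; 1, 0, 0; 0, 1, 0],
    !![1, 0, 0; 0, ζ, 0; 0, 0, ζ^2],
    !![0, 0, 1; ζ, 0, 0; 0, ζ^2, 0],
    !![1, 0, 0; 0, ζ^2, 0; 0, 0, ζ],
    !![0, 1, 0; 0, 0, 1; 1, 0, 0]]

theorem ζ_pow_three : ζ ^ 3 = 1 := by
  rw [ζ, ← Complex.exp_nat_mul, ← Complex.exp_two_pi_mul_I]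
  congr 1
  push_cast
  ring

theorem conj_ζ : starRingEnd ℂ ζ = ζ ^ 2 := by
  have h_inv : starRingEnd ℂ ζ = ζ⁻¹ := by
    rw [ζ, ← Complex.exp_conj, ← Complex.exp_neg]
    congr 1
    simp [Complex.conj_ofReal, neg_div, map_ofNat]
  rw [h_inv]
  exact inv_eq_of_mul_eq_one_right (by rw [← ζ_pow_three]; ring)

theorem conj_ζ_sq : starRingEnd ℂ ζ ^ 2 = ζ := by
  rw [conj_ζ]
  linear_combination ζ * ζ_pow_three

theorem conj_a : starRingEnd ℂ a = a := Complex.conj_ofReal _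

/-- Complex conjugation permutes the summands, and no power of `ζ` is needed. -/
theorem map_conj_m (i : Fin 18) :
    (m i).map (starRingEnd ℂ) =
      m (![0, 3, 6, 1, 4, 7, 2, 5, 8, 9, 12, 15, 10, 13, 16, 11, 14, 17] i) := by
  fin_cases i <;> ext r c <;> fin_cases r <;> fin_cases c <;>
    simp [m, conj_ζ_sq, conj_a] <;> simp [conj_ζ]

/-- Entrywise complex conjugation preserves the set of summands of the Waring
decomposition up to powers of ζ (a Galois symmetry). -/
theorem conjugation_symmetry :
    ∀ i : Fin 18, ∃ (j : Fin 18) (k : Fin 3),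
      (m i).map (starRingEnd ℂ) = ζ ^ (k : ℕ) • m j := by
  exact fun i => ⟨_, 0, by simpa using map_conj_m i⟩
end

section
/- The group of all bijections σ : 𝔽₃² → 𝔽₃² that map every collinear triple of points to a collinear triple has exactly 432 elements. -/
/-- Three points of the affine plane 𝔽₃² are collinear if the differences
y − x and z − x are linearly dependent over 𝔽₃ (triples with a repetition
count as collinear). -/
def Coll (x y z : Fin 2 → ZMod 3) : Prop :=
  ¬ LinearIndependent (ZMod 3) ![y - x, z - x]

/-- A bijection of 𝔽₃² preserves collinearity if it maps every collinear
triple to a collinear triple. -/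
def PreservesColl (σ : Equiv.Perm (Fin 2 → ZMod 3)) : Prop :=
  ∀ x y z, Coll x y z → Coll (σ x) (σ y) (σ z)

theorem not_linearIndependent_pair_zmod_three_iff (u v : Fin 2 → ZMod 3) :
    ¬ LinearIndependent (ZMod 3) ![u, v] ↔ u = 0 ∨ v = 0 ∨ u = v ∨ u + v = 0 := by
  have key : ∀ a b c d : ZMod 3,
      (¬ ∀ s t : ZMod 3, (s * a + t * c = 0 ∧ s * b + t * d = 0) → s = 0 ∧ t = 0) ↔
        (a = 0 ∧ b = 0) ∨ (c = 0 ∧ d = 0) ∨ (a = c ∧ b = d) ∨ (a + c = 0 ∧ b + d = 0) := by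
    decide
  simpa only [LinearIndependent.pair_iff, funext_iff, Fin.forall_fin_two, Pi.add_apply,
    Pi.smul_apply, smul_eq_mul, Pi.zero_apply] using key (u 0) (u 1) (v 0) (v 1)

theorem add_self_add_self_zmod_three (x : Fin 2 → ZMod 3) : x + x + x = 0 := by
  have key : ∀ a : ZMod 3, a + a + a = 0 := by decide
  exact funext fun i => key (x i)

theorem coll_iff (x y z : Fin 2 → ZMod 3) :
    Coll x y z ↔ y = x ∨ z = x ∨ y = z ∨ x + y + z = 0 := by
  have h : y - x + (z - x) = x + y + z := by
    linear_combination -add_self_add_self_zmod_three x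
  rw [Coll, not_linearIndependent_pair_zmod_three_iff, h, sub_eq_zero, sub_eq_zero, sub_left_inj]

theorem eq_of_add_self_add_eq_zero {x z : Fin 2 → ZMod 3} (h : x + x + z = 0) : z = x := by
  linear_combination h - add_self_add_self_zmod_three x

theorem preservesColl_iff (σ : Equiv.Perm (Fin 2 → ZMod 3)) :
    PreservesColl σ ↔ ∀ x y z, x + y + z = 0 → σ x + σ y + σ z = 0 := by
  constructor
  · intro h x y z hs
    by_cases hxy : y = x
    · subst hxy
      rw [eq_of_add_self_add_eq_zero hs, add_self_add_self_zmod_three]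
    by_cases hxz : z = x
    · subst hxz
      exact absurd (eq_of_add_self_add_eq_zero (by rw [← hs]; abel)) hxy
    by_cases hyz : y = z
    · subst hyz
      exact absurd (eq_of_add_self_add_eq_zero (by rw [← hs]; abel)).symm hxy
    have := (coll_iff _ _ _).1 (h x y z ((coll_iff _ _ _).2 (by simp [hs])))
    simpa only [σ.injective.eq_iff, hxy, hxz, hyz, false_or] using this
  · intro h x y z hc
    rw [coll_iff] at hc ⊢
    simp only [σ.injective.eq_iff]
    exact hc.imp_right (Or.imp_right (Or.imp_right (h x y z)))

/-- The affine bijection `x ↦ f x + b` of 𝔽₃². -/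
def affinePerm (b : Fin 2 → ZMod 3) (f : (Fin 2 → ZMod 3) ≃ₗ[ZMod 3] (Fin 2 → ZMod 3)) :
    Equiv.Perm (Fin 2 → ZMod 3) :=
  f.toEquiv.trans (Equiv.addRight b)

theorem affinePerm_apply (b : Fin 2 → ZMod 3)
    (f : (Fin 2 → ZMod 3) ≃ₗ[ZMod 3] (Fin 2 → ZMod 3)) (x : Fin 2 → ZMod 3) :
    affinePerm b f x = f x + b := rfl

theorem preservesColl_affinePerm (b : Fin 2 → ZMod 3)
    (f : (Fin 2 → ZMod 3) ≃ₗ[ZMod 3] (Fin 2 → ZMod 3)) : PreservesColl (affinePerm b f) := by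
  rw [preservesColl_iff]
  intro x y z h
  have hf : f x + f y + f z = 0 := by rw [← map_add, ← map_add, h, map_zero]
  simp only [affinePerm_apply]
  linear_combination hf + add_self_add_self_zmod_three b

theorem affinePerm_injective {b c : Fin 2 → ZMod 3}
    {f g : (Fin 2 → ZMod 3) ≃ₗ[ZMod 3] (Fin 2 → ZMod 3)}
    (h : affinePerm b f = affinePerm c g) : b = c ∧ f = g := by
  have happ (x) : f x + b = g x + c := Equiv.congr_fun h x
  have hbc : b = c := by simpa using happ 0
  subst hbc
  exact ⟨rfl, LinearEquiv.ext fun x => add_right_cancel (happ x)⟩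

theorem PreservesColl.exists_affinePerm_eq {σ : Equiv.Perm (Fin 2 → ZMod 3)}
    (h : PreservesColl σ) : ∃ b f, affinePerm b f = σ := by
  rw [preservesColl_iff] at h
  have hadd (x y) : σ (x + y) - σ 0 = (σ x - σ 0) + (σ y - σ 0) := by
    have h₁ := h x y (-(x + y)) (by abel)
    have h₂ := h (x + y) (-(x + y)) 0 (by abel)
    linear_combination h₂ - h₁
  let f : (Fin 2 → ZMod 3) →+ (Fin 2 → ZMod 3) := AddMonoidHom.mk' (fun x => σ x - σ 0) hadd
  have hf : Function.Bijective (f.toZModLinearMap 3) :=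
    (σ.trans (Equiv.subRight (σ 0))).bijective
  exact ⟨σ 0, LinearEquiv.ofBijective _ hf, Equiv.ext fun x => sub_add_cancel (σ x) (σ 0)⟩

theorem card_linearEquiv_zmod_three :
    Nat.card ((Fin 2 → ZMod 3) ≃ₗ[ZMod 3] (Fin 2 → ZMod 3)) = 48 := by
  have : Fact (Nat.Prime 3) := ⟨Nat.prime_three⟩
  rw [← Nat.card_congr (Matrix.GeneralLinearGroup.toLin.trans
    (LinearMap.GeneralLinearGroup.generalLinearEquiv (ZMod 3) (Fin 2 → ZMod 3))).toEquiv,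
    Matrix.card_GL_field]
  simp [Fin.prod_univ_two, ZMod.card]

/-- The group of collinearity-preserving bijections of 𝔽₃² has exactly 432 elements. -/
theorem card_collineation_group :
    Nat.card {σ : Equiv.Perm (Fin 2 → ZMod 3) // PreservesColl σ} = 432 := by
  have hbij : Function.Bijective
      (fun p : (Fin 2 → ZMod 3) × ((Fin 2 → ZMod 3) ≃ₗ[ZMod 3] (Fin 2 → ZMod 3)) =>
        (⟨affinePerm p.1 p.2, preservesColl_affinePerm p.1 p.2⟩ :
          {σ : Equiv.Perm (Fin 2 → ZMod 3) // PreservesColl σ})) := by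
    constructor
    · rintro ⟨b, f⟩ ⟨c, g⟩ h
      exact Prod.ext_iff.2 (affinePerm_injective (congrArg Subtype.val h))
    · rintro ⟨σ, hσ⟩
      obtain ⟨b, f, rfl⟩ := hσ.exists_affinePerm_eq
      exact ⟨(b, f), rfl⟩
  rw [← Nat.card_congr (Equiv.ofBijective _ hbij), Nat.card_prod, card_linearEquiv_zmod_three]
  simp [Nat.card_eq_fintype_card, ZMod.card]
end

section
/- Let G = { P ∈ GL₃(ℂ) : for every i ∈ {1,…,18} there exist j ∈ {1,…,18} and k ∈ {0,1,2} with P·mᵢ·P⁻¹ = ζᵏ·mⱼ }. Then G is a subgroup of GL₃(ℂ) containing all nonzero scalar matrices, and its image in PGL₃(ℂ) = GL₃(ℂ)/ℂ× has exactly 216 elements. (This is the PGL₃(ℂ)-part of the symmetry group of the Waring decomposition, isomorphic to ℤ₃² ⋊ SL(2,𝔽₃).) -/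
open Matrix

/-- P ∈ GL₃(ℂ) is a symmetry of the decomposition if conjugation by P permutes
the summands mᵢ up to powers of ζ. -/
def SymmCond (P : GL (Fin 3) ℂ) : Prop :=
  ∀ i : Fin 18, ∃ (j : Fin 18) (k : Fin 3),
    (P : Matrix (Fin 3) (Fin 3) ℂ) * m i * ((P⁻¹ : GL (Fin 3) ℂ) : Matrix (Fin 3) (Fin 3) ℂ)
      = ζ ^ (k : ℕ) • m j

theorem isPrimitiveRoot_ζ : IsPrimitiveRoot ζ 3 := by
  have h := Complex.isPrimitiveRoot_exp 3 (by norm_num)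
  simpa [ζ] using h

theorem ζ_ne_zero : ζ ≠ 0 := isPrimitiveRoot_ζ.ne_zero (by norm_num)

theorem ζ_sq_add_ζ_add_one : ζ ^ 2 + ζ + 1 = 0 := by
  have h := isPrimitiveRoot_ζ.geom_sum_eq_zero (by norm_num)
  simp only [Finset.sum_range_succ, Finset.sum_range_zero] at h
  linear_combination h

theorem a_ne_zero : a ≠ 0 := by
  unfold a
  rw [Complex.ofReal_ne_zero, neg_ne_zero]
  positivity

/-- The additive character `x ↦ ζ ^ x` of `ℤ/3`. -/
noncomputable def χ (x : Fin 3) : ℂ := ζ ^ (x : ℕ)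

@[simp] theorem χ_zero : χ 0 = 1 := by simp [χ]

theorem χ_mul (x y : Fin 3) : χ x * χ y = χ (x + y) := by
  have h := ζ_pow_three
  fin_cases x <;> fin_cases y <;> simp [χ] <;> grind

theorem χ_ne_zero (x : Fin 3) : χ x ≠ 0 := pow_ne_zero _ ζ_ne_zero

theorem χ_injective : Function.Injective χ := fun x y h =>
  Fin.ext (isPrimitiveRoot_ζ.pow_inj x.2 y.2 h)

/-- The Heisenberg matrix with parameters `(a, b, c)`, equal to `ζ ^ c • X ^ a * Z ^ b` for the
shift `X` and the clock `Z`. -/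
noncomputable def heis (p : Fin 3 × Fin 3 × Fin 3) : Matrix (Fin 3) (Fin 3) ℂ :=
  of fun r s => if s = r + p.1 then χ (p.2.2 + p.2.1 * s) else 0

/-- The phase point operator with parameters `(t, e)`. -/
noncomputable def phasePoint (t e : Fin 3) : Matrix (Fin 3) (Fin 3) ℂ :=
  of fun r s => if s = t - r then χ (e * (s - r)) else 0

theorem heis_mul_apply (p : Fin 3 × Fin 3 × Fin 3) (M : Matrix (Fin 3) (Fin 3) ℂ) (r s : Fin 3) :
    (heis p * M) r s = χ (p.2.2 + p.2.1 * (r + p.1)) * M (r + p.1) s := by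
  simp [heis, Matrix.mul_apply]

theorem mul_heis_apply (p : Fin 3 × Fin 3 × Fin 3) (M : Matrix (Fin 3) (Fin 3) ℂ) (r s : Fin 3) :
    (M * heis p) r s = M r (s - p.1) * χ (p.2.2 + p.2.1 * s) := by
  have h : ∀ x : Fin 3, s = x + p.1 ↔ s - p.1 = x := fun x => by
    generalize p.1 = y; revert s x y; decide
  simp [heis, Matrix.mul_apply, h]

theorem phasePoint_mul_apply (t e : Fin 3) (M : Matrix (Fin 3) (Fin 3) ℂ) (r s : Fin 3) :
    (phasePoint t e * M) r s = χ (e * (t - r - r)) * M (t - r) s := by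
  simp [phasePoint, Matrix.mul_apply]

theorem mul_phasePoint_apply (t e : Fin 3) (M : Matrix (Fin 3) (Fin 3) ℂ) (r s : Fin 3) :
    (M * phasePoint t e) r s = M r (t - s) * χ (e * (s - (t - s))) := by
  have h : ∀ x : Fin 3, s = t - x ↔ t - s = x := fun x => by revert s t x; decide
  simp [phasePoint, Matrix.mul_apply, h]

theorem heis_mul_heis (p q : Fin 3 × Fin 3 × Fin 3) :
    heis p * heis q = heis (p.1 + q.1, p.2.1 + q.2.1, p.2.2 + q.2.2 - p.2.1 * q.1) := by
  obtain ⟨a, b, c⟩ := p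
  obtain ⟨a', b', c'⟩ := q
  ext r s
  rw [heis_mul_apply]
  have h : s = r + a + a' ↔ s = r + (a + a') := by rw [add_assoc]
  simp only [heis, of_apply, h]
  split_ifs with hs
  · rw [χ_mul]
    subst hs
    congr 1
    clear h
    revert a b c a' b' c' r
    decide +kernel
  · simp

theorem heis_zero : heis 0 = 1 := by
  ext r s
  simp [heis, Matrix.one_apply, eq_comm]

theorem heis_injective : Function.Injective heis := by
  rintro ⟨a, b, c⟩ ⟨a', b', c'⟩ h
  have key : ∀ r s, heis (a, b, c) r s = heis (a', b', c') r s := fun r s => by rw [h]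
  simp only [heis, of_apply] at key
  have ha : a = a' := by
    by_contra hne
    have := key 0 a
    simp [hne, χ_ne_zero] at this
  subst ha
  have hs : ∀ s, c + b * s = c' + b' * s := fun s => by
    have := key (s - a) s
    simp only [sub_add_cancel, if_true] at this
    exact χ_injective this
  have h0 := hs 0
  have h1 := hs 1
  simp only [mul_zero, add_zero, mul_one] at h0 h1
  subst h0
  rw [add_left_cancel h1]

/-- A matrix commuting with the shift and the clock is scalar. -/
theorem eq_smul_one_of_commute {M : Matrix (Fin 3) (Fin 3) ℂ}
    (hX : M * heis (1, 0, 0) = heis (1, 0, 0) * M) (hZ : M * heis (0, 1, 0) = heis (0, 1, 0) * M) :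
    M = M 0 0 • (1 : Matrix (Fin 3) (Fin 3) ℂ) := by
  have diag : ∀ r, M (r + 1) (r + 1) = M r r := fun r => by
    have := congrFun (congrFun hX r) (r + 1)
    rw [heis_mul_apply, mul_heis_apply] at this
    simpa using this.symm
  have off : ∀ r s, r ≠ s → M r s = 0 := fun r s hrs => by
    have := congrFun (congrFun hZ r) s
    rw [heis_mul_apply, mul_heis_apply] at this
    simp only [sub_zero, add_zero, zero_add, one_mul] at this
    have h2 : M r s * (χ s - χ r) = 0 := by linear_combination this
    exact (mul_eq_zero.mp h2).resolve_right (sub_ne_zero.mpr fun h => hrs (χ_injective h.symm))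
  have d0 := diag 0
  have d1 := diag 1
  ext r s
  by_cases hrs : r = s
  · subst hrs
    fin_cases r
    · simp
    · simpa using d0
    · simpa using d1.trans d0
  · simp [hrs, off r s hrs]

/-- The parameters of the phase point operators `1 - m i`, for the first nine indices `i`. -/
def phaseIndex : Fin 9 → Fin 3 × Fin 3 :=
  ![(1, 0), (0, 1), (2, 2), (0, 2), (2, 0), (1, 1), (2, 1), (1, 2), (0, 0)]

/-- The parameters of the Heisenberg matrices `m i`, for the last eight indices `i`. -/
def heisIndex : Fin 8 → Fin 3 × Fin 3 × Fin 3 :=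
  ![(1, 1, 2), (2, 2, 2), (1, 2, 1), (2, 0, 0), (0, 1, 0), (2, 1, 1), (0, 2, 0), (1, 0, 0)]

theorem m_castAdd (i : Fin 9) :
    m (Fin.castAdd 9 i) = 1 - phasePoint (phaseIndex i).1 (phaseIndex i).2 := by
  have h1 : (-1 : Fin 3) = 2 := rfl
  have h2 : (-2 : Fin 3) = 1 := rfl
  fin_cases i <;> ext r s <;> fin_cases r <;> fin_cases s <;>
    simp [m, phasePoint, phaseIndex, χ, Fin.castAdd, h1, h2]

theorem m_nine : m 9 = a • (1 : Matrix (Fin 3) (Fin 3) ℂ) := rfl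

theorem m_natAdd (i : Fin 8) : m (Fin.natAdd 10 i) = heis (heisIndex i) := by
  fin_cases i <;> ext r s <;> fin_cases r <;> fin_cases s <;>
    simp [m, heis, heisIndex, χ, Fin.natAdd]

theorem index_cases (i : Fin 18) :
    (∃ j : Fin 9, i = Fin.castAdd 9 j) ∨ i = 9 ∨ ∃ j : Fin 8, i = Fin.natAdd 10 j := by
  revert i; decide

theorem χ_smul_heis (k : Fin 3) (p : Fin 3 × Fin 3 × Fin 3) :
    χ k • heis p = heis (p.1, p.2.1, p.2.2 + k) := by
  ext r s
  simp only [heis, Matrix.smul_apply, of_apply, smul_eq_mul, mul_ite, mul_zero, χ_mul]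
  congr 2
  abel_nf

/-- The Heisenberg parameters of non-scalar matrices. -/
abbrev IsNonScalar (p : Fin 3 × Fin 3 × Fin 3) : Prop := p.1 ≠ 0 ∨ p.2.1 ≠ 0

theorem exists_heis_eq_m {p : Fin 3 × Fin 3 × Fin 3} (hp : IsNonScalar p) :
    ∃ (j : Fin 8) (k : Fin 3), heis p = ζ ^ (k : ℕ) • m (Fin.natAdd 10 j) := by
  have h : ∀ p, IsNonScalar p → ∃ (j : Fin 8) (k : Fin 3),
      p = ((heisIndex j).1, (heisIndex j).2.1, (heisIndex j).2.2 + k) := by decide +kernel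
  obtain ⟨j, k, hjk⟩ := h p hp
  exact ⟨j, k, by rw [m_natAdd, hjk, ← χ_smul_heis]; rfl⟩

theorem symmCond_of_conj (P : GL (Fin 3) ℂ)
    (hw : ∀ p, IsNonScalar p → ∃ q, IsNonScalar q ∧ P.1 * heis p = heis q * P.1)
    (hA : ∀ t e, ∃ t' e', P.1 * phasePoint t e = phasePoint t' e' * P.1) : SymmCond P := by
  have conj : ∀ {M N : Matrix (Fin 3) (Fin 3) ℂ}, P.1 * M = N * P.1 →
      P.1 * M * (P⁻¹ : GL (Fin 3) ℂ).1 = N := fun h => by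
    rw [h, mul_assoc, P.mul_inv, mul_one]
  intro i
  obtain ⟨i, rfl⟩ | rfl | ⟨i, rfl⟩ := index_cases i
  · obtain ⟨t, e, h⟩ := hA (phaseIndex i).1 (phaseIndex i).2
    have hj : ∀ t e, ∃ j, phaseIndex j = (t, e) := by decide
    obtain ⟨j, hj⟩ := hj t e
    refine ⟨Fin.castAdd 9 j, 0, conj ?_⟩
    simp [m_castAdd, hj, mul_sub, sub_mul, h]
  · exact ⟨9, 0, conj (by simp [m_nine])⟩
  · have hi : ∀ i, IsNonScalar (heisIndex i) := by decide
    obtain ⟨q, hq, h⟩ := hw _ (hi i)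
    obtain ⟨j, k, hjk⟩ := exists_heis_eq_m hq
    exact ⟨Fin.natAdd 10 j, k, conj (by rw [m_natAdd, h, hjk])⟩

/-- The finite set of all `ζ ^ k • m j`. -/
def summandOrbit : Set (Matrix (Fin 3) (Fin 3) ℂ) :=
  Set.range fun x : Fin 18 × Fin 3 => ζ ^ (x.2 : ℕ) • m x.1

theorem symmCond_iff (P : GL (Fin 3) ℂ) : SymmCond P ↔
    Set.MapsTo (fun M => P.1 * M * (P⁻¹ : GL (Fin 3) ℂ).1) summandOrbit summandOrbit := by
  constructor
  · rintro h _ ⟨⟨i, l⟩, rfl⟩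
    obtain ⟨j, k, hjk⟩ := h i
    refine ⟨⟨j, l + k⟩, ?_⟩
    have := χ_mul l k
    simp only [χ] at this
    simp only [mul_smul_comm, smul_mul_assoc, hjk, smul_smul, this]
  · intro h i
    obtain ⟨⟨j, k⟩, hjk⟩ := h ⟨(i, 0), rfl⟩
    exact ⟨j, k, by simpa using hjk.symm⟩

/-- The group of symmetries of the decomposition. -/
def symmGroup : Subgroup (GL (Fin 3) ℂ) where
  carrier := {P | SymmCond P}
  one_mem' := (symmCond_iff 1).2 fun M hM => by simpa using hM
  mul_mem' {P Q} hP hQ := (symmCond_iff _).2 fun M hM => by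
    simpa [mul_assoc] using (symmCond_iff P).1 hP ((symmCond_iff Q).1 hQ hM)
  inv_mem' {P} hP := (symmCond_iff _).2 fun M hM => by
    have inv_conj : ∀ M : Matrix (Fin 3) (Fin 3) ℂ,
        (P⁻¹ : GL (Fin 3) ℂ).1 * (P.1 * M * (P⁻¹ : GL (Fin 3) ℂ).1) * P.1 = M := fun M => by
      rw [mul_assoc, mul_assoc, P.inv_mul, mul_one, ← mul_assoc, P.inv_mul, one_mul]
    have hsurj := (((Set.finite_range _).injOn_iff_bijOn_of_mapsTo ((symmCond_iff P).1 hP)).1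
      (Function.LeftInverse.injective
        (g := fun M => (P⁻¹ : GL (Fin 3) ℂ).1 * M * P.1) inv_conj).injOn).surjOn
    obtain ⟨N, hN, rfl⟩ := hsurj hM
    beta_reduce
    rwa [inv_inv, inv_conj]

/-- `P` conjugates the shift and the clock to the Heisenberg matrices with parameters `t`. -/
def ConjPair (P : GL (Fin 3) ℂ) (t : (Fin 3 × Fin 3 × Fin 3) × (Fin 3 × Fin 3 × Fin 3)) : Prop :=
  P.1 * heis (1, 0, 0) = heis t.1 * P.1 ∧ P.1 * heis (0, 1, 0) = heis t.2 * P.1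

theorem ConjPair.eq {P : GL (Fin 3) ℂ} {t u : (Fin 3 × Fin 3 × Fin 3) × (Fin 3 × Fin 3 × Fin 3)}
    (ht : ConjPair P t) (hu : ConjPair P u) : t = u :=
  Prod.ext (heis_injective (P.isUnit.mul_right_cancel (ht.1.symm.trans hu.1)))
    (heis_injective (P.isUnit.mul_right_cancel (ht.2.symm.trans hu.2)))

theorem mem_center_iff (P : GL (Fin 3) ℂ) : P ∈ Subgroup.center (GL (Fin 3) ℂ) ↔
    ∃ c : ℂ, P.1 = c • (1 : Matrix (Fin 3) (Fin 3) ℂ) := by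
  rw [Matrix.GeneralLinearGroup.mem_center_iff_val_mem_range_scalar]
  simp only [Set.mem_range, Matrix.scalar_apply, ← Matrix.smul_one_eq_diagonal, eq_comm]

theorem ConjPair.inv_mul_mem_center {P Q : GL (Fin 3) ℂ}
    {t : (Fin 3 × Fin 3 × Fin 3) × (Fin 3 × Fin 3 × Fin 3)}
    (hP : ConjPair P t) (hQ : ConjPair Q t) : P⁻¹ * Q ∈ Subgroup.center (GL (Fin 3) ℂ) := by
  have key : ∀ {M N : Matrix (Fin 3) (Fin 3) ℂ}, P.1 * M = N * P.1 → Q.1 * M = N * Q.1 →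
      (P⁻¹ * Q).1 * M = M * (P⁻¹ * Q).1 := fun {M N} h h' => by
    apply P.isUnit.mul_left_cancel
    rw [← mul_assoc, ← mul_assoc, h, Units.val_mul, ← mul_assoc, P.mul_inv, one_mul, mul_assoc N,
      ← mul_assoc P.1, P.mul_inv, one_mul, h']
  exact (mem_center_iff _).2 ⟨_, eq_smul_one_of_commute (key hP.1 hQ.1) (key hP.2 hQ.2)⟩

theorem ConjPair.mul_of_mem_center {P Q : GL (Fin 3) ℂ}
    {t : (Fin 3 × Fin 3 × Fin 3) × (Fin 3 × Fin 3 × Fin 3)}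
    (hP : ConjPair P t) (h : P⁻¹ * Q ∈ Subgroup.center (GL (Fin 3) ℂ)) : ConjPair Q t := by
  obtain ⟨c, hc⟩ := (mem_center_iff _).1 h
  have hQ : Q.1 = c • P.1 := by
    rw [← mul_inv_cancel_left P Q, Units.val_mul, hc, mul_smul_comm, mul_one]
  exact ⟨by rw [hQ, smul_mul_assoc, hP.1, mul_smul_comm],
    by rw [hQ, smul_mul_assoc, hP.2, mul_smul_comm]⟩

theorem trace_m_castAdd (i : Fin 9) : (m (Fin.castAdd 9 i)).trace = 2 := by
  fin_cases i <;> simp [m, Matrix.trace, Fin.sum_univ_three, Fin.castAdd] <;> norm_num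

theorem trace_m_nine : (m 9).trace ≠ 0 := by
  simp [m_nine, a_ne_zero]

theorem trace_m_natAdd (i : Fin 8) : (m (Fin.natAdd 10 i)).trace = 0 := by
  have h := ζ_sq_add_ζ_add_one
  fin_cases i <;> simp [m, Matrix.trace, Fin.sum_univ_three, Fin.natAdd] <;> grind

theorem SymmCond.exists_heis {P : GL (Fin 3) ℂ} (hP : SymmCond P) (i : Fin 8) :
    ∃ p, P.1 * heis (heisIndex i) = heis p * P.1 := by
  obtain ⟨j, k, h⟩ := hP (Fin.natAdd 10 i)
  have htr : (m j).trace = 0 := by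
    have := congrArg Matrix.trace h
    rw [Matrix.trace_mul_cycle, P.inv_mul, one_mul, trace_m_natAdd, Matrix.trace_smul,
      smul_eq_mul] at this
    exact (mul_eq_zero.mp this.symm).resolve_left (χ_ne_zero k)
  obtain ⟨j, rfl⟩ | rfl | ⟨j, rfl⟩ := index_cases j
  · simp [trace_m_castAdd] at htr
  · exact absurd htr trace_m_nine
  · refine ⟨((heisIndex j).1, (heisIndex j).2.1, (heisIndex j).2.2 + k), ?_⟩
    rw [← χ_smul_heis, χ, ← m_natAdd, ← m_natAdd, ← h, mul_assoc _ _ P.1, P.inv_mul, mul_one]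

/-- The pairs of Heisenberg parameters with the commutation relation of the shift and the
clock. -/
abbrev SymplecticPair :=
  {t : (Fin 3 × Fin 3 × Fin 3) × (Fin 3 × Fin 3 × Fin 3) //
    t.1.1 * t.2.2.1 - t.1.2.1 * t.2.1 = 1}

theorem SymmCond.exists_conjPair {P : GL (Fin 3) ℂ} (hP : SymmCond P) :
    ∃ t : SymplecticPair, ConjPair P t := by
  obtain ⟨p, hp⟩ := hP.exists_heis 7
  obtain ⟨q, hq⟩ := hP.exists_heis 4
  refine ⟨⟨(p, q), ?_⟩, hp, hq⟩
  change P.1 * heis (1, 0, 0) = _ at hp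
  change P.1 * heis (0, 1, 0) = _ at hq
  have hcomm : heis (1, 0, 0) * heis (0, 1, 0) = χ 1 • (heis (0, 1, 0) * heis (1, 0, 0)) := by
    rw [heis_mul_heis, heis_mul_heis, χ_smul_heis]
    rfl
  have h : heis p * heis q = χ 1 • (heis q * heis p) := by
    apply P.isUnit.mul_right_cancel
    rw [smul_mul_assoc, mul_assoc, ← hq, ← mul_assoc, ← hp, mul_assoc, mul_assoc (heis q), ← hp,
      ← mul_assoc (heis q), ← hq, hcomm, mul_smul_comm, mul_assoc]
  rw [heis_mul_heis, heis_mul_heis, χ_smul_heis] at h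
  have h2 := congrArg (fun t => t.2.2) (heis_injective h)
  obtain ⟨a, b, c⟩ := p
  obtain ⟨a', b', c'⟩ := q
  clear * - h2
  revert a b c a' b' c'
  decide +kernel

/-- A Heisenberg matrix as an invertible matrix. -/
noncomputable def heisGL (p : Fin 3 × Fin 3 × Fin 3) : GL (Fin 3) ℂ where
  val := heis p
  inv := heis (-p.1, -p.2.1, -p.2.2 - p.2.1 * p.1)
  val_inv := by
    rw [heis_mul_heis, ← heis_zero]
    congr 1
    revert p
    decide
  inv_val := by
    rw [heis_mul_heis, ← heis_zero]
    congr 1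
    revert p
    decide

/-- The discrete Fourier transform. -/
noncomputable def fourierGL : GL (Fin 3) ℂ where
  val := of fun r s => χ (r * s)
  inv := (3⁻¹ : ℂ) • of fun r s => χ (-(r * s))
  val_inv := by
    have h := ζ_sq_add_ζ_add_one
    have h1 : (-1 : Fin 3) = 2 := rfl
    have h2 : (-2 : Fin 3) = 1 := rfl
    ext r s
    fin_cases r <;> fin_cases s <;>
      simp [Matrix.mul_apply, Fin.sum_univ_three, χ, h1, h2] <;> grind
  inv_val := by
    have h := ζ_sq_add_ζ_add_one
    have h1 : (-1 : Fin 3) = 2 := rfl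
    have h2 : (-2 : Fin 3) = 1 := rfl
    ext r s
    fin_cases r <;> fin_cases s <;>
      simp [Matrix.mul_apply, Fin.sum_univ_three, χ, h1, h2] <;> grind

/-- The diagonal matrix with the quadratic phases `ζ ^ r ^ 2`. -/
noncomputable def quadGL : GL (Fin 3) ℂ where
  val := diagonal fun r => χ (r * r)
  inv := diagonal fun r => χ (-(r * r))
  val_inv := by simp [χ_mul]
  inv_val := by simp [χ_mul]

theorem heisGL_conj (p q : Fin 3 × Fin 3 × Fin 3) : (heisGL p).1 * heis q =
    heis (q.1, q.2.1, q.2.2 + q.2.1 * p.1 - p.2.1 * q.1) * (heisGL p).1 := by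
  simp only [heisGL, heis_mul_heis]
  congr 1
  revert p q
  decide +kernel

theorem fourierGL_conj (p : Fin 3 × Fin 3 × Fin 3) :
    fourierGL.1 * heis p = heis (p.2.1, -p.1, p.2.2 + p.1 * p.2.1) * fourierGL.1 := by
  ext r s
  rw [heis_mul_apply, mul_heis_apply]
  simp only [fourierGL, of_apply, χ_mul]
  congr 1
  revert p r s
  decide +kernel

theorem quadGL_conj (p : Fin 3 × Fin 3 × Fin 3) :
    quadGL.1 * heis p = heis (p.1, p.2.1 + p.1, p.2.2 + p.1 * p.1) * quadGL.1 := by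
  ext r s
  simp only [quadGL, diagonal_mul, mul_diagonal, heis, of_apply, mul_ite, ite_mul, mul_zero,
    zero_mul, χ_mul]
  split_ifs with h
  · subst h
    congr 1
    revert p r
    decide +kernel
  · rfl

theorem symmCond_heisGL (p : Fin 3 × Fin 3 × Fin 3) : SymmCond (heisGL p) := by
  refine symmCond_of_conj _ (fun q hq => ⟨_, ?_, heisGL_conj p q⟩) fun t e =>
    ⟨t - 2 * p.1, e - p.2.1, ?_⟩
  · exact hq
  · ext r s
    rw [mul_phasePoint_apply, phasePoint_mul_apply]
    simp only [heisGL, heis, of_apply, mul_ite, ite_mul, mul_zero, zero_mul, χ_mul]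
    obtain ⟨a, b, c⟩ := p
    have h : (t - s = r + a) ↔ s = t - 2 * a - r + a := by
      clear c b
      revert t s r a
      decide +kernel
    simp only [h]
    split_ifs with hs
    · congr 1
      clear h
      subst hs
      revert t e r a b c
      decide +kernel
    · rfl

theorem symmCond_fourierGL : SymmCond fourierGL := by
  refine symmCond_of_conj _ (fun q hq => ⟨_, ?_, fourierGL_conj q⟩) fun t e => ⟨2 * e, t, ?_⟩
  · revert q
    decide
  · ext r s
    rw [mul_phasePoint_apply, phasePoint_mul_apply]
    simp only [fourierGL, of_apply, χ_mul]
    congr 1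
    revert t e r s
    decide +kernel

theorem symmCond_quadGL : SymmCond quadGL := by
  refine symmCond_of_conj _ (fun q hq => ⟨_, ?_, quadGL_conj q⟩) fun t e => ⟨t, e - t, ?_⟩
  · revert q
    decide
  · ext r s
    simp only [quadGL, diagonal_mul, mul_diagonal, phasePoint, of_apply, mul_ite, ite_mul,
      mul_zero, zero_mul, χ_mul]
    split_ifs with h
    · subst h
      congr 1
      revert t e r
      decide +kernel
    · rfl

/-- If conjugation by a symmetry `Q` acts on Heisenberg parameters through `f`, then the pairs
realised by symmetries are stable under `f`. -/
theorem exists_conjPair_iterate {Q : GL (Fin 3) ℂ} (hQ : SymmCond Q)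
    {f : Fin 3 × Fin 3 × Fin 3 → Fin 3 × Fin 3 × Fin 3}
    (hf : ∀ p, Q.1 * heis p = heis (f p) * Q.1) (n : ℕ)
    {t : (Fin 3 × Fin 3 × Fin 3) × (Fin 3 × Fin 3 × Fin 3)}
    (ht : ∃ P, SymmCond P ∧ ConjPair P t) : ∃ P, SymmCond P ∧ ConjPair P ((Prod.map f f)^[n] t) := by
  induction n with
  | zero => exact ht
  | succ n ih =>
    obtain ⟨P, hP, h1, h2⟩ := ih
    rw [Function.iterate_succ_apply']
    refine ⟨Q * P, symmGroup.mul_mem hQ hP, ?_, ?_⟩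
    · rw [Units.val_mul, mul_assoc, h1, ← mul_assoc, hf, mul_assoc]
      rfl
    · rw [Units.val_mul, mul_assoc, h2, ← mul_assoc, hf, mul_assoc]
      rfl

theorem SymplecticPair.exists_conjPair (t : SymplecticPair) :
    ∃ P, SymmCond P ∧ ConjPair P t := by
  let h (p q : Fin 3 × Fin 3 × Fin 3) : Fin 3 × Fin 3 × Fin 3 :=
    (q.1, q.2.1, q.2.2 + q.2.1 * p.1 - p.2.1 * q.1)
  let F (p : Fin 3 × Fin 3 × Fin 3) : Fin 3 × Fin 3 × Fin 3 := (p.2.1, -p.1, p.2.2 + p.1 * p.2.1)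
  let D (p : Fin 3 × Fin 3 × Fin 3) : Fin 3 × Fin 3 × Fin 3 :=
    (p.1, p.2.1 + p.1, p.2.2 + p.1 * p.1)
  have key : ∀ t : SymplecticPair, ∃ (k n : Fin 3) (l : Fin 4) (x z : Fin 3),
      (Prod.map (h (x, z, 0)) (h (x, z, 0)))^[1] ((Prod.map D D)^[k] ((Prod.map F F)^[l]
        ((Prod.map D D)^[n] ((1, 0, 0), (0, 1, 0))))) = t.1 := by
    decide +kernel
  obtain ⟨k, n, l, x, z, ht⟩ := key t
  rw [← ht]
  refine exists_conjPair_iterate (symmCond_heisGL (x, z, 0)) (heisGL_conj _) 1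
    (exists_conjPair_iterate symmCond_quadGL quadGL_conj k
      (exists_conjPair_iterate symmCond_fourierGL fourierGL_conj l
        (exists_conjPair_iterate symmCond_quadGL quadGL_conj n
          ⟨1, symmGroup.one_mem, ?_, ?_⟩))) <;> simp

theorem card_symplecticPair : Nat.card SymplecticPair = 216 := by
  rw [Nat.card_eq_fintype_card]
  decide +kernel

theorem card_map_symmGroup :
    Nat.card (symmGroup.map (QuotientGroup.mk' (Subgroup.center (GL (Fin 3) ℂ)))) = 216 := by
  choose P hP hPt using SymplecticPair.exists_conjPair
  rw [← card_symplecticPair]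
  refine (Nat.card_congr (Equiv.ofBijective
    (fun t => ⟨QuotientGroup.mk' _ (P t), Subgroup.mem_map_of_mem _ (hP t)⟩) ⟨?_, ?_⟩)).symm
  · intro t u htu
    have := QuotientGroup.eq.1 (congrArg Subtype.val htu)
    exact Subtype.ext (((hPt t).mul_of_mem_center this).eq (hPt u))
  · rintro ⟨_, Q, hQ, rfl⟩
    obtain ⟨t, ht⟩ := SymmCond.exists_conjPair hQ
    exact ⟨t, Subtype.ext (QuotientGroup.eq.2 ((hPt t).inv_mul_mem_center ht))⟩

/-- The symmetries form a subgroup G of GL₃(ℂ) containing all nonzero scalar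
matrices (the center of GL₃(ℂ), i.e. ℂ×), and the image of G in
PGL₃(ℂ) = GL₃(ℂ)/ℂ× has exactly 216 elements. -/
theorem pgl_symmetry_group_card :
    ∃ G : Subgroup (GL (Fin 3) ℂ),
      (∀ P : GL (Fin 3) ℂ, P ∈ G ↔ SymmCond P) ∧
      (∀ P : GL (Fin 3) ℂ, P ∈ Subgroup.center (GL (Fin 3) ℂ) ↔
        ∃ c : ℂ, (P : Matrix (Fin 3) (Fin 3) ℂ) = c • (1 : Matrix (Fin 3) (Fin 3) ℂ)) ∧
      (∀ P : GL (Fin 3) ℂ,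
        (∃ c : ℂ, (P : Matrix (Fin 3) (Fin 3) ℂ) = c • (1 : Matrix (Fin 3) (Fin 3) ℂ)) → P ∈ G) ∧
      Nat.card (G.map (QuotientGroup.mk' (Subgroup.center (GL (Fin 3) ℂ)))) = 216 := by
  refine ⟨symmGroup, fun P => Iff.rfl, mem_center_iff, ?_, card_map_symmGroup⟩
  rintro P ⟨c, hc⟩
  exact symmCond_of_conj P (fun p hp => ⟨p, hp, by simp [hc]⟩) fun t e => ⟨t, e, by simp [hc]⟩
end

section
/- Consider the set Γ' of bijections φ : M₃(ℂ) → M₃(ℂ) of one of the four forms φ(X) = P·X·P⁻¹, φ(X) = P·Xᵀ·P⁻¹, φ(X) = P·X̄·P⁻¹, or φ(X) = P·X̄ᵀ·P⁻¹ for some P ∈ GL₃(ℂ) (where X̄ is the entrywise complex conjugate), such that for every i ∈ {1,…,18} there exist j ∈ {1,…,18} and k ∈ {0,1,2} with φ(mᵢ) = ζᵏ·mⱼ. Then Γ' is a group under composition and has exactly 864 elements. (Including the Galois symmetry of complex conjugation yields a symmetry group of order 864.) -/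
open Matrix

/-- φ has one of the four forms X ↦ PXP⁻¹, X ↦ PXᵀP⁻¹, X ↦ PX̄P⁻¹, X ↦ PX̄ᵀP⁻¹
for an invertible matrix P, where X̄ denotes the entrywise complex conjugate. -/
def IsSemilinearSymmetryForm (φ : Equiv.Perm (Matrix (Fin 3) (Fin 3) ℂ)) : Prop :=
  ∃ P : Matrix (Fin 3) (Fin 3) ℂ, IsUnit P ∧
    ((∀ X, φ X = P * X * P⁻¹) ∨
     (∀ X, φ X = P * Xᵀ * P⁻¹) ∨
     (∀ X, φ X = P * (X.map (starRingEnd ℂ)) * P⁻¹) ∨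
     (∀ X, φ X = P * (X.map (starRingEnd ℂ))ᵀ * P⁻¹))

/-- φ permutes the summands of the Waring decomposition up to powers of ζ. -/
def FixesDecomposition (φ : Equiv.Perm (Matrix (Fin 3) (Fin 3) ℂ)) : Prop :=
  ∀ i : Fin 18, ∃ (j : Fin 18) (k : Fin 3), φ (m i) = ζ ^ (k : ℕ) • m j

namespace Hesse

/-- The ring `ℤ[ω]` of Eisenstein integers. -/
abbrev Eis := QuadraticAlgebra ℤ (-1) (-1)

/-- The primitive cube root of unity `ω`. -/
def omega : Eis := ⟨0, 1⟩

/-- The points of the affine plane over the field with three elements. -/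
abbrev Pt := Fin 3 × Fin 3

/-- The rank one summands, indexed by the nine inflection points of the Hesse pencil. -/
def hesse (x : Pt) : Matrix (Fin 3) (Fin 3) Eis :=
  of fun r s => if r = x.1 ∨ s = x.1 then 0 else if r = s then 1
    else if r = x.1 + 1 then -omega ^ (2 * x.2 : ℕ) else -omega ^ (x.2 : ℕ)

/-- Representatives of the Heisenberg group modulo its centre. -/
def heis (v : Pt) : Matrix (Fin 3) (Fin 3) Eis :=
  of fun r s => if r = s + v.1 then omega ^ (v.2 * s : ℕ) else 0

/-- The discrete Fourier transform. -/
def dft : Matrix (Fin 3) (Fin 3) Eis := of fun r s => omega ^ (r * s : ℕ)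

/-- A diagonal matrix normalizing the Heisenberg group, acting on points as a shear. -/
def shear : Matrix (Fin 3) (Fin 3) Eis := diagonal ![omega, 1, 1]

/-- The summands `m i` over the Eisenstein integers, except for the scalar one. -/
def summand : Fin 18 → Matrix (Fin 3) (Fin 3) Eis :=
  ![!![1, -1, 0; -1, 1, 0; 0, 0, 0],
    !![0, 0, 0; 0, 1, -omega; 0, -omega^2, 1],
    !![1, 0, -omega; 0, 0, 0; -omega^2, 0, 1],
    !![0, 0, 0; 0, 1, -omega^2; 0, -omega, 1],
    !![1, 0, -1; 0, 0, 0; -1, 0, 1],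
    !![1, -omega, 0; -omega^2, 1, 0; 0, 0, 0],
    !![1, 0, -omega^2; 0, 0, 0; -omega, 0, 1],
    !![1, -omega^2, 0; -omega, 1, 0; 0, 0, 0],
    !![0, 0, 0; 0, 1, -1; 0, -1, 1],
    0,
    !![0, 1, 0; 0, 0, omega; omega^2, 0, 0],
    !![0, 0, 1; omega^2, 0, 0; 0, omega, 0],
    !![0, 1, 0; 0, 0, omega^2; omega, 0, 0],
    !![0, 0, 1; 1, 0, 0; 0, 1, 0],
    !![1, 0, 0; 0, omega, 0; 0, 0, omega^2],
    !![0, 0, 1; omega, 0, 0; 0, omega^2, 0],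
    !![1, 0, 0; 0, omega^2, 0; 0, 0, omega],
    !![0, 1, 0; 0, 0, 1; 1, 0, 0]]

/-- The affine map with linear part sending the standard basis to `q.1`, `q.2.1`,
and translation part `q.2.2`. -/
def aff (q : Pt × Pt × Pt) (x : Pt) : Pt := (x.1 : ℕ) • q.1 + (x.2 : ℕ) • q.2.1 + q.2.2

/-- The linear part of `aff q` is invertible. -/
def Nondegenerate (q : Pt × Pt × Pt) : Prop := q.1 ≠ 0 ∧ ∀ k : Fin 3, q.2.1 ≠ (k : ℕ) • q.1

instance : DecidablePred Nondegenerate := fun _ => inferInstanceAs (Decidable (_ ∧ _))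

theorem card_nondegenerate : Fintype.card {q // Nondegenerate q} = 432 := by decide +kernel

theorem nondegenerate_of_injective :
    ∀ q, Function.Injective (aff q) → Nondegenerate q := by
  unfold Function.Injective
  decide +kernel

theorem aff_injective {q q' : Pt × Pt × Pt} (h : ∀ x, aff q x = aff q' x) : q = q' := by
  have h0 : q.2.2 = q'.2.2 := by simpa [aff] using h 0
  have h1 := h (1, 0)
  have h2 := h (0, 1)
  simp only [aff, h0, Fin.val_one, Fin.val_zero, one_smul, zero_smul, add_zero, zero_add,
    add_left_inj] at h1 h2
  exact Prod.ext h1 (Prod.ext h2 h0)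

theorem exists_word : ∀ q : Pt × Pt, Nondegenerate (q.1, q.2, 0) →
    ∃ i : Fin 3, ∃ s : Fin 4, ∃ j : Fin 3, ∃ t : Fin 2, ∀ x,
      (fun x : Pt => (x.1, x.2 + x.1))^[i] ((fun x : Pt => (-x.2, x.1))^[s]
        ((fun x : Pt => (x.1, x.2 + x.1))^[j] ((fun x : Pt => (x.1, -x.2))^[t] x))) =
      aff (q.1, q.2, 0) x := by
  decide +kernel

theorem summand_eq : ∀ i, i ≠ 9 → (∃ x, summand i = hesse x) ∨
    ∃ v, v ≠ 0 ∧ ∃ k : Fin 3, summand i = omega ^ (k : ℕ) • heis v := by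
  decide +kernel

theorem hesse_eq : ∀ x, ∃ i, i ≠ 9 ∧ hesse x = summand i := by decide +kernel

theorem heis_eq : ∀ v, v ≠ 0 →
    ∃ i, i ≠ 9 ∧ ∃ k : Fin 3, heis v = omega ^ (k : ℕ) • summand i := by
  decide +kernel

theorem trace_hesse : ∀ x, (hesse x).trace = 2 := by decide +kernel

theorem trace_heis : ∀ v, v ≠ 0 → (heis v).trace = 0 := by decide +kernel

theorem hesse_ne_zero : ∀ x, hesse x ≠ 0 := by decide +kernel

theorem hesse_injective : ∀ x y, hesse x = hesse y → x = y := by decide +kernel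

theorem hesse_mul_heis_injective :
    ∀ x y v, hesse x * heis v = hesse y * heis v → x = y := by
  decide +kernel

theorem exists_sum_hesse (r s : Fin 3) :
    ∃ c : Pt → Eis, ∑ x, c x • hesse x = (6 : Eis) • single r s 1 := by
  refine ⟨fun x => if r = s then (if x.1 = r then -1 else 1)
    else if x.1 = r ∨ x.1 = s then 0
    else -2 * omega ^ (if r = x.1 + 1 then x.2 else 2 * x.2 : ℕ), ?_⟩
  revert r s
  decide +kernel

/-- Conjugation by `P` permutes the points through `g` and the Heisenberg group up to phases. -/
structure IsClifford (P : Matrix (Fin 3) (Fin 3) Eis) (g : Pt → Pt) : Prop where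
  exists_mul_eq : ∃ Q, P * Q = (3 : Eis) • 1
  mul_hesse : ∀ x, P * hesse x = hesse (g x) * P
  mul_heis : ∀ v, ∃ w, (v ≠ 0 → w ≠ 0) ∧
    ∃ k : Fin 3, P * heis v = omega ^ (k : ℕ) • (heis w * P)

theorem isClifford_dft : IsClifford dft fun x => (-x.2, x.1) := by
  refine ⟨⟨of fun r s => omega ^ (2 * r * s : ℕ), ?_⟩, ?_, ?_⟩ <;> decide +kernel

theorem isClifford_shear : IsClifford shear fun x => (x.1, x.2 + x.1) := by
  refine ⟨⟨(3 : Eis) • diagonal ![omega ^ 2, 1, 1], ?_⟩, ?_, ?_⟩ <;> decide +kernel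

theorem isClifford_heis (v : Pt) : IsClifford (heis v) fun x => x + v := by
  refine ⟨⟨(3 : Eis) • (heis v)ᵀ.map star, ?_⟩, ?_, ?_⟩ <;> revert v <;> decide +kernel

theorem transpose_hesse : ∀ x, (hesse x)ᵀ = hesse (x.1, -x.2) := by decide +kernel

theorem transpose_heis : ∀ v, ∃ w, (v ≠ 0 → w ≠ 0) ∧
    ∃ k : Fin 3, (heis v)ᵀ = omega ^ (k : ℕ) • heis w := by
  decide +kernel

theorem transpose_star_hesse : ∀ x, ((hesse x).map star)ᵀ = hesse x := by decide +kernel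

theorem transpose_star_heis : ∀ v, ∃ w, (v ≠ 0 → w ≠ 0) ∧
    ∃ k : Fin 3, ((heis v).map star)ᵀ = omega ^ (k : ℕ) • heis w := by
  decide +kernel

theorem isPrimitiveRoot_zeta : IsPrimitiveRoot ζ 3 :=
  Complex.isPrimitiveRoot_exp 3 (by norm_num)

theorem zeta_pow_three : ζ ^ 3 = 1 := isPrimitiveRoot_zeta.pow_eq_one

theorem zeta_ne_zero : ζ ≠ 0 := isPrimitiveRoot_zeta.ne_zero (by norm_num)

theorem zeta_sq : ζ ^ 2 = -1 - ζ := by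
  have h := isPrimitiveRoot_zeta.geom_sum_eq_zero (by norm_num)
  simp only [Finset.sum_range_succ, Finset.sum_range_zero, pow_zero, pow_one] at h
  linear_combination h

theorem conj_zeta : (starRingEnd ℂ) ζ = ζ ^ 2 := by
  have h : (starRingEnd ℂ) ζ * ζ = 1 := by
    rw [← Complex.normSq_eq_conj_mul_self, Complex.normSq_eq_norm_sq,
      Complex.norm_eq_one_of_pow_eq_one zeta_pow_three (by norm_num)]
    simp
  calc (starRingEnd ℂ) ζ = (starRingEnd ℂ) ζ * ζ ^ 3 := by rw [zeta_pow_three, mul_one]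
    _ = ((starRingEnd ℂ) ζ * ζ) * ζ ^ 2 := by ring
    _ = ζ ^ 2 := by rw [h, one_mul]

theorem a_pow_three : a ^ 3 = -1 / 2 := by
  have h : ((2 : ℝ) ^ (-(1 / 3 : ℝ))) ^ 3 = 1 / 2 := by
    rw [← Real.rpow_natCast, ← Real.rpow_mul (by norm_num)]
    norm_num [Real.rpow_neg_one]
  rw [a, ← Complex.ofReal_pow, neg_pow, h]
  norm_num

/-- The embedding of the Eisenstein integers in the complex numbers. -/
noncomputable def toC : Eis →+* ℂ :=
  (QuadraticAlgebra.lift (R := ℤ) (a := -1) (b := -1)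
    ⟨ζ, by simp only [neg_smul, one_smul]; linear_combination zeta_sq⟩ : Eis →ₐ[ℤ] ℂ)

theorem toC_apply (z : Eis) : toC z = z.re + z.im * ζ := by
  simp [toC, QuadraticAlgebra.lift]

theorem toC_omega : toC omega = ζ := by simp [toC_apply, omega]

theorem toC_star (z : Eis) : toC (star z) = (starRingEnd ℂ) (toC z) := by
  simp only [toC_apply, map_add, map_mul, conj_zeta, zeta_sq, QuadraticAlgebra.re_star,
    QuadraticAlgebra.im_star, map_intCast]
  push_cast
  ring

theorem toC_injective : Function.Injective toC := by
  rw [injective_iff_map_eq_zero]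
  intro z hz
  have h := congrArg (starRingEnd ℂ) hz
  rw [← toC_star, toC_apply, QuadraticAlgebra.re_star, QuadraticAlgebra.im_star, map_zero] at h
  rw [toC_apply] at hz
  push_cast at h
  have hd : (1 + 2 * ζ) ≠ 0 := fun h0 => by
    have : (1 + 2 * ζ) ^ 2 = -3 := by linear_combination 4 * zeta_sq
    rw [h0] at this
    norm_num at this
  have him : (z.im : ℂ) = 0 := by
    have : (z.im : ℂ) * (1 + 2 * ζ) = 0 := by linear_combination hz - h
    exact (mul_eq_zero.mp this).resolve_right hd
  have hre : (z.re : ℂ) = 0 := by simpa [him] using hz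
  exact QuadraticAlgebra.ext (by exact_mod_cast hre) (by exact_mod_cast him)

/-- The entrywise embedding of matrices. -/
noncomputable def toMat : Matrix (Fin 3) (Fin 3) Eis →+* Matrix (Fin 3) (Fin 3) ℂ :=
  toC.mapMatrix

theorem toMat_injective : Function.Injective toMat := Matrix.map_injective toC_injective

theorem toMat_smul (z : Eis) (X : Matrix (Fin 3) (Fin 3) Eis) :
    toMat (z • X) = toC z • toMat X := by
  ext; simp [toMat]

theorem toMat_omega_smul (n : ℕ) (X : Matrix (Fin 3) (Fin 3) Eis) :
    toMat (omega ^ n • X) = ζ ^ n • toMat X := by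
  rw [toMat_smul, map_pow, toC_omega]

theorem toMat_transpose (X : Matrix (Fin 3) (Fin 3) Eis) : toMat Xᵀ = (toMat X)ᵀ := rfl

theorem toMat_map_star (X : Matrix (Fin 3) (Fin 3) Eis) :
    toMat (X.map star) = (toMat X).map (starRingEnd ℂ) := by
  ext; simp [toMat, toC_star]

theorem trace_toMat (X : Matrix (Fin 3) (Fin 3) Eis) : (toMat X).trace = toC X.trace :=
  (AddMonoidHom.map_trace toC X).symm

theorem m_nine : m 9 = a • 1 := rfl

theorem m_eq_toMat : ∀ i, i ≠ 9 → m i = toMat (summand i) := by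
  intro i hi
  ext r s
  fin_cases i <;> first | exact absurd rfl hi | skip
  all_goals fin_cases r <;> fin_cases s <;> simp [m, summand, toMat, toC_omega]

theorem m_cases (i : Fin 18) : (∃ x, m i = toMat (hesse x)) ∨ m i = a • 1 ∨
    ∃ v, v ≠ 0 ∧ ∃ n : ℕ, m i = ζ ^ n • toMat (heis v) := by
  by_cases hi : i = 9
  · exact .inr (.inl (hi ▸ m_nine))
  · rw [m_eq_toMat i hi]
    rcases summand_eq i hi with ⟨x, hx⟩ | ⟨v, hv, k, hk⟩
    · exact .inl ⟨x, by rw [hx]⟩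
    · exact .inr (.inr ⟨v, hv, k, by rw [hk, toMat_omega_smul]⟩)

theorem exists_m_eq_hesse (x : Pt) : ∃ i, toMat (hesse x) = m i := by
  obtain ⟨i, hi, h⟩ := hesse_eq x
  exact ⟨i, by rw [h, m_eq_toMat i hi]⟩

theorem exists_m_eq_heis {v : Pt} (hv : v ≠ 0) :
    ∃ i, ∃ n : ℕ, toMat (heis v) = ζ ^ n • m i := by
  obtain ⟨i, hi, k, h⟩ := heis_eq v hv
  exact ⟨i, k, by rw [h, m_eq_toMat i hi, toMat_omega_smul]⟩

/-- The identity or complex conjugation. -/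
noncomputable def gal (ε : Bool) : ℂ →+* ℂ := bif ε then starRingEnd ℂ else RingHom.id ℂ

theorem gal_gal (ε δ : Bool) (z : ℂ) : gal ε (gal δ z) = gal (ε ^^ δ) z := by
  cases ε <;> cases δ <;> simp [gal]

theorem gal_a (ε : Bool) : gal ε a = a := by
  cases ε <;> simp [gal, a]

theorem exists_gal_zeta_pow (ε : Bool) (n : ℕ) : ∃ k : ℕ, gal ε (ζ ^ n) = ζ ^ k := by
  cases ε
  · exact ⟨n, rfl⟩
  · exact ⟨2 * n, by simp [gal, conj_zeta, pow_mul]⟩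

theorem gal_ext {ε δ : Bool} (h : gal ε Complex.I = gal δ Complex.I) : ε = δ := by
  have hI : -Complex.I ≠ Complex.I := by
    intro h
    have := congrArg Complex.im h
    norm_num at this
  cases ε <;> cases δ <;> simp_all [gal, eq_comm]

/-- `φ` is conjugation by an invertible matrix, up to transposition and the Galois action. -/
def IsForm (ε : Bool) (φ : Equiv.Perm (Matrix (Fin 3) (Fin 3) ℂ)) : Prop :=
  ∃ P : Matrix (Fin 3) (Fin 3) ℂ, IsUnit P ∧
    ((∀ X, φ X = P * X.map (gal ε) * P⁻¹) ∨ (∀ X, φ X = P * (X.map (gal ε))ᵀ * P⁻¹))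

theorem isSemilinearSymmetryForm_iff {φ : Equiv.Perm (Matrix (Fin 3) (Fin 3) ℂ)} :
    IsSemilinearSymmetryForm φ ↔ ∃ ε, IsForm ε φ := by
  have hid : ∀ X : Matrix (Fin 3) (Fin 3) ℂ, X.map (gal false) = X := fun X => by
    ext; simp [gal]
  simp only [Bool.exists_bool, IsForm, hid]
  constructor
  · rintro ⟨P, hP, h | h | h | h⟩
    · exact .inl ⟨P, hP, .inl h⟩
    · exact .inl ⟨P, hP, .inr h⟩
    · exact .inr ⟨P, hP, .inl h⟩
    · exact .inr ⟨P, hP, .inr h⟩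
  · rintro (⟨P, hP, h | h⟩ | ⟨P, hP, h | h⟩)
    · exact ⟨P, hP, .inl h⟩
    · exact ⟨P, hP, .inr (.inl h)⟩
    · exact ⟨P, hP, .inr (.inr (.inl h))⟩
    · exact ⟨P, hP, .inr (.inr (.inr h))⟩

namespace IsForm

variable {ε δ : Bool} {φ ψ : Equiv.Perm (Matrix (Fin 3) (Fin 3) ℂ)}

theorem one : IsForm false 1 := ⟨1, isUnit_one, .inl fun X => by ext; simp [gal]⟩

theorem map_add (h : IsForm ε φ) (X Y : Matrix (Fin 3) (Fin 3) ℂ) :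
    φ (X + Y) = φ X + φ Y := by
  obtain ⟨P, -, h | h⟩ := h <;>
  simp [h, Matrix.map_add, mul_add, add_mul]

theorem map_smul (h : IsForm ε φ) (z : ℂ) (X : Matrix (Fin 3) (Fin 3) ℂ) :
    φ (z • X) = gal ε z • φ X := by
  have hz : (z • X).map (gal ε) = gal ε z • X.map (gal ε) := by ext; simp
  obtain ⟨P, -, h | h⟩ := h <;> simp [h, hz]

theorem map_one (h : IsForm ε φ) : φ 1 = 1 := by
  obtain ⟨P, hP, h | h⟩ := h <;>
  simp [h, Matrix.mul_nonsing_inv P ((Matrix.isUnit_iff_isUnit_det P).mp hP)]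

theorem trace (h : IsForm ε φ) (X : Matrix (Fin 3) (Fin 3) ℂ) :
    (φ X).trace = gal ε X.trace := by
  obtain ⟨P, hP, h | h⟩ := h <;>
  rw [h, Matrix.trace_mul_comm, ← mul_assoc,
    Matrix.nonsing_inv_mul P ((Matrix.isUnit_iff_isUnit_det P).mp hP), one_mul] <;>
  simp [Matrix.trace]

theorem map_mul (h : IsForm ε φ) :
    (∀ X Y, φ (X * Y) = φ X * φ Y) ∨ (∀ X Y, φ (X * Y) = φ Y * φ X) := by
  obtain ⟨P, hP, h | h⟩ := h
  · refine .inl fun X Y => ?_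
    have hi := Matrix.nonsing_inv_mul P ((Matrix.isUnit_iff_isUnit_det P).mp hP)
    simp only [h, Matrix.map_mul, mul_assoc]
    rw [← mul_assoc P⁻¹ P, hi, one_mul]
  · refine .inr fun X Y => ?_
    have hi := Matrix.nonsing_inv_mul P ((Matrix.isUnit_iff_isUnit_det P).mp hP)
    simp only [h, Matrix.map_mul, Matrix.transpose_mul, mul_assoc]
    rw [← mul_assoc P⁻¹ P, hi, one_mul]

theorem mul (h : IsForm ε φ) (h' : IsForm δ ψ) : IsForm (ε ^^ δ) (φ * ψ) := by
  obtain ⟨P, hP, h⟩ := h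
  obtain ⟨Q, hQ, h'⟩ := h'
  have hg : ∀ X : Matrix (Fin 3) (Fin 3) ℂ,
      (X.map (gal δ)).map (gal ε) = X.map (gal (ε ^^ δ)) := fun X => by
    ext; simp [gal_gal]
  have hQ' : IsUnit (Q.map (gal ε)) := hQ.map (gal ε).mapMatrix
  have hinv : Q⁻¹.map (gal ε) = (Q.map (gal ε))⁻¹ := by
    refine (Matrix.inv_eq_right_inv ?_).symm
    rw [← Matrix.map_mul, Matrix.mul_nonsing_inv Q ((Matrix.isUnit_iff_isUnit_det Q).mp hQ)]
    simp
  have hT : IsUnit ((Q.map (gal ε))ᵀ)⁻¹ := by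
    rw [Matrix.isUnit_nonsing_inv_iff, Matrix.isUnit_transpose]
    exact hQ'
  have hTT : (((Q.map (gal ε))ᵀ)⁻¹)⁻¹ = (Q.map (gal ε))ᵀ :=
    Matrix.nonsing_inv_nonsing_inv _
      ((Matrix.isUnit_iff_isUnit_det _).mp (Matrix.isUnit_transpose _ |>.mpr hQ'))
  have hTT' : ((Qᵀ.map (gal ε))⁻¹)⁻¹ = Qᵀ.map (gal ε) := by
    simpa only [← Matrix.transpose_map] using hTT
  rcases h with h | h <;> rcases h' with h' | h'
  · refine ⟨P * Q.map (gal ε), hP.mul hQ', .inl fun X => ?_⟩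
    simp only [Equiv.Perm.mul_apply, h, h', Matrix.map_mul, hg, hinv, Matrix.mul_inv_rev,
      mul_assoc]
  · refine ⟨P * Q.map (gal ε), hP.mul hQ', .inr fun X => ?_⟩
    simp only [Equiv.Perm.mul_apply, h, h', Matrix.map_mul, ← Matrix.transpose_map, hg, hinv,
      Matrix.mul_inv_rev, mul_assoc]
  · refine ⟨P * ((Q.map (gal ε))ᵀ)⁻¹, hP.mul hT, .inr fun X => ?_⟩
    simp only [Equiv.Perm.mul_apply, h, h', Matrix.map_mul, hg, hinv, Matrix.mul_inv_rev,
      Matrix.transpose_mul, Matrix.transpose_nonsing_inv, mul_assoc, hTT]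
  · refine ⟨P * ((Q.map (gal ε))ᵀ)⁻¹, hP.mul hT, .inl fun X => ?_⟩
    simp only [Equiv.Perm.mul_apply, h, h', Matrix.map_mul, ← Matrix.transpose_map, hg, hinv,
      Matrix.mul_inv_rev, Matrix.transpose_mul, Matrix.transpose_nonsing_inv,
      Matrix.transpose_transpose, mul_assoc, hTT']

end IsForm

theorem fixesDecomposition_iff {φ : Equiv.Perm (Matrix (Fin 3) (Fin 3) ℂ)} :
    FixesDecomposition φ ↔ ∀ i, ∃ j, ∃ n : ℕ, φ (m i) = ζ ^ n • m j := by
  refine ⟨fun h i => ?_, fun h i => ?_⟩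
  · obtain ⟨j, k, hk⟩ := h i
    exact ⟨j, k, hk⟩
  · obtain ⟨j, n, hn⟩ := h i
    exact ⟨j, ⟨n % 3, Nat.mod_lt _ (by norm_num)⟩, by
      rw [hn, pow_eq_pow_mod n zeta_pow_three]⟩

theorem fixesDecomposition_mul {ε : Bool} {φ ψ : Equiv.Perm (Matrix (Fin 3) (Fin 3) ℂ)}
    (hf : IsForm ε φ) (h : FixesDecomposition φ) (h' : FixesDecomposition ψ) :
    FixesDecomposition (φ * ψ) := by
  rw [fixesDecomposition_iff] at *
  intro i
  obtain ⟨j, n, hn⟩ := h' i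
  obtain ⟨k, l, hl⟩ := h j
  obtain ⟨n', hn'⟩ := exists_gal_zeta_pow ε n
  exact ⟨k, n' + l, by
    rw [Equiv.Perm.mul_apply, hn, hf.map_smul, hl, hn', smul_smul, pow_add]⟩

/-- `φ` is a symmetry of the decomposition of Galois type `ε`, acting on the nine points
through `σ`. -/
structure IsSymmetry (ε : Bool) (σ : Pt → Pt)
    (φ : Equiv.Perm (Matrix (Fin 3) (Fin 3) ℂ)) : Prop where
  isForm : IsForm ε φ
  fixes : FixesDecomposition φ
  map_hesse : ∀ x, φ (toMat (hesse x)) = toMat (hesse (σ x))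

namespace IsSymmetry

variable {ε δ : Bool} {σ τ : Pt → Pt} {φ ψ : Equiv.Perm (Matrix (Fin 3) (Fin 3) ℂ)}

theorem one : IsSymmetry false id 1 :=
  ⟨.one, fun i => ⟨i, 0, by simp⟩, fun _ => rfl⟩

theorem mul (h : IsSymmetry ε σ φ) (h' : IsSymmetry δ τ ψ) :
    IsSymmetry (ε ^^ δ) (σ ∘ τ) (φ * ψ) :=
  ⟨h.isForm.mul h'.isForm, fixesDecomposition_mul h.isForm h.fixes h'.fixes, fun x => by
    rw [Equiv.Perm.mul_apply, h'.map_hesse, h.map_hesse, Function.comp_apply]⟩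

theorem pow (h : IsSymmetry false σ φ) (n : ℕ) : IsSymmetry false σ^[n] (φ ^ n) := by
  induction n with
  | zero => exact one
  | succ n ih =>
    rw [pow_succ, Function.iterate_succ]
    exact ih.mul h

theorem of_form (hf : IsForm ε φ) (hσ : ∀ x, φ (toMat (hesse x)) = toMat (hesse (σ x)))
    (hv : ∀ v, ∃ w, (v ≠ 0 → w ≠ 0) ∧ ∃ n : ℕ, φ (toMat (heis v)) = ζ ^ n • toMat (heis w)) :
    IsSymmetry ε σ φ := by
  refine ⟨hf, fixesDecomposition_iff.mpr fun i => ?_, hσ⟩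
  rcases m_cases i with ⟨x, hx⟩ | h | ⟨v, hv0, n, hn⟩
  · obtain ⟨j, hj⟩ := exists_m_eq_hesse (σ x)
    exact ⟨j, 0, by rw [hx, hσ, hj, pow_zero, one_smul]⟩
  · exact ⟨9, 0, by rw [h, m_nine, hf.map_smul, gal_a, hf.map_one, pow_zero, one_smul]⟩
  · obtain ⟨w, hw, k, hk⟩ := hv v
    obtain ⟨j, l, hj⟩ := exists_m_eq_heis (hw hv0)
    obtain ⟨n', hn'⟩ := exists_gal_zeta_pow ε n
    exact ⟨j, n' + k + l, by
      rw [hn, hf.map_smul, hk, hj, hn', smul_smul, smul_smul, pow_add, pow_add, mul_assoc]⟩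

end IsSymmetry

theorem IsClifford.exists_isSymmetry {P : Matrix (Fin 3) (Fin 3) Eis} {g : Pt → Pt}
    (h : IsClifford P g) : ∃ φ, IsSymmetry false g φ := by
  obtain ⟨Q, hQ⟩ := h.exists_mul_eq
  have hQ' : toMat P * ((3 : ℂ)⁻¹ • toMat Q) = 1 := by
    rw [Matrix.mul_smul, ← _root_.map_mul, hQ, toMat_smul, _root_.map_one, smul_smul,
      _root_.map_ofNat, inv_mul_cancel₀ three_ne_zero, one_smul]
  have hP : IsUnit (toMat P) := IsUnit.of_mul_eq_one _ hQ'
  have hdet := (Matrix.isUnit_iff_isUnit_det _).mp hP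
  have hr := Matrix.mul_nonsing_inv _ hdet
  have hl := Matrix.nonsing_inv_mul _ hdet
  let φ : Equiv.Perm (Matrix (Fin 3) (Fin 3) ℂ) :=
    { toFun := fun X => toMat P * X * (toMat P)⁻¹
      invFun := fun X => (toMat P)⁻¹ * X * toMat P
      left_inv := fun X => by
        simp only [← mul_assoc, hl, one_mul]
        rw [mul_assoc, hl, mul_one]
      right_inv := fun X => by
        simp only [← mul_assoc, hr, one_mul]
        rw [mul_assoc, hr, mul_one] }
  have hφ : ∀ X Y, toMat P * X = Y * toMat P → φ X = Y := fun X Y hXY => by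
    change toMat P * X * (toMat P)⁻¹ = Y
    rw [hXY, mul_assoc, hr, mul_one]
  refine ⟨φ, .of_form ⟨toMat P, hP, .inl fun X => by
    change toMat P * X * (toMat P)⁻¹ = _
    congr 2⟩ (fun x => hφ _ _ ?_) fun v => ?_⟩
  · rw [← _root_.map_mul, h.mul_hesse, _root_.map_mul]
  · obtain ⟨w, hw, k, hk⟩ := h.mul_heis v
    refine ⟨w, hw, k, hφ _ _ ?_⟩
    rw [← _root_.map_mul, hk, toMat_omega_smul, _root_.map_mul, Matrix.smul_mul]

theorem exists_isSymmetry_transpose : ∃ φ, IsSymmetry false (fun x => (x.1, -x.2)) φ := by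
  let φ : Equiv.Perm (Matrix (Fin 3) (Fin 3) ℂ) :=
    Function.Involutive.toPerm Matrix.transpose Matrix.transpose_transpose
  have hφ : ∀ X, φ X = Xᵀ := fun _ => rfl
  refine ⟨φ, .of_form ⟨1, isUnit_one, .inr fun X => ?_⟩ (fun x => ?_) fun v => ?_⟩
  · ext; simp [hφ, gal]
  · rw [hφ, ← toMat_transpose, transpose_hesse]
  · obtain ⟨w, hw, k, hk⟩ := transpose_heis v
    exact ⟨w, hw, k, by rw [hφ, ← toMat_transpose, hk, toMat_omega_smul]⟩

theorem exists_isSymmetry_conjTranspose : ∃ φ, IsSymmetry true id φ := by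
  let φ : Equiv.Perm (Matrix (Fin 3) (Fin 3) ℂ) :=
    Function.Involutive.toPerm Matrix.conjTranspose Matrix.conjTranspose_conjTranspose
  have hφ : ∀ X, φ X = (X.map (starRingEnd ℂ))ᵀ := fun _ => rfl
  refine ⟨φ, .of_form ⟨1, isUnit_one, .inr fun X => ?_⟩ (fun x => ?_) fun v => ?_⟩
  · ext; simp [hφ, gal]
  · rw [hφ, ← toMat_map_star, ← toMat_transpose, transpose_star_hesse, id]
  · obtain ⟨w, hw, k, hk⟩ := transpose_star_heis v
    exact ⟨w, hw, k, by
      rw [hφ, ← toMat_map_star, ← toMat_transpose, hk, toMat_omega_smul]⟩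

theorem exists_isSymmetry {q : Pt × Pt × Pt} (hq : Nondegenerate q) (ε : Bool) :
    ∃ φ, IsSymmetry ε (aff q) φ := by
  suffices h : ∃ φ, IsSymmetry false (aff q) φ by
    cases ε
    · exact h
    · obtain ⟨φ, hφ⟩ := h
      obtain ⟨ψ, hψ⟩ := exists_isSymmetry_conjTranspose
      exact ⟨φ * ψ, hφ.mul hψ⟩
  obtain ⟨i, s, j, t, h⟩ := exists_word (q.1, q.2.1) hq
  obtain ⟨S, hS⟩ := isClifford_shear.exists_isSymmetry
  obtain ⟨F, hF⟩ := isClifford_dft.exists_isSymmetry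
  obtain ⟨T, hT⟩ := exists_isSymmetry_transpose
  obtain ⟨W, hW⟩ := (isClifford_heis q.2.2).exists_isSymmetry
  have key := hW.mul ((hS.pow i).mul ((hF.pow s).mul ((hS.pow j).mul (hT.pow t))))
  convert! Exists.intro _ key using 4
  funext x
  simp only [Function.comp_apply, h x]
  simp [aff]

theorem span_hesse : Submodule.span ℂ (Set.range fun x => toMat (hesse x)) = ⊤ := by
  have hs : ∀ r s : Fin 3, (single r s 1 : Matrix (Fin 3) (Fin 3) ℂ) ∈
      Submodule.span ℂ (Set.range fun x => toMat (hesse x)) := fun r s => by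
    obtain ⟨c, hc⟩ := exists_sum_hesse r s
    have h := congrArg toMat hc
    have h1 : toMat (single r s 1) = single r s 1 := by
      simp [toMat, Matrix.map_single]
    rw [map_sum, toMat_smul, h1, map_ofNat] at h
    have h2 : (single r s 1 : Matrix (Fin 3) (Fin 3) ℂ) =
        (6 : ℂ)⁻¹ • ∑ x, toMat (c x • hesse x) := by
      rw [h, smul_smul, inv_mul_cancel₀ (by norm_num), one_smul]
    rw [h2]
    refine Submodule.smul_mem _ _ (Submodule.sum_mem _ fun x _ => ?_)
    rw [toMat_smul]
    exact Submodule.smul_mem _ _ (Submodule.subset_span ⟨x, rfl⟩)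
  rw [eq_top_iff]
  intro X _
  rw [Matrix.matrix_eq_sum_single X]
  refine Submodule.sum_mem _ fun r _ => Submodule.sum_mem _ fun s _ => ?_
  have : single r s (X r s) = X r s • (single r s 1 : Matrix (Fin 3) (Fin 3) ℂ) := by
    rw [Matrix.smul_single, smul_eq_mul, mul_one]
  rw [this]
  exact Submodule.smul_mem _ _ (hs r s)

namespace IsSymmetry

variable {ε δ : Bool} {σ τ : Pt → Pt} {φ ψ : Equiv.Perm (Matrix (Fin 3) (Fin 3) ℂ)}

theorem unique (h : IsSymmetry ε σ φ) (h' : IsSymmetry ε σ ψ) : φ = ψ := by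
  ext1 X
  have hX : X ∈ Submodule.span ℂ (Set.range fun x => toMat (hesse x)) :=
    span_hesse ▸ Submodule.mem_top
  induction hX using Submodule.span_induction with
  | mem X hX =>
    obtain ⟨x, rfl⟩ := hX
    simp only [h.map_hesse, h'.map_hesse]
  | zero =>
    have := h.isForm.map_smul 0 0
    have := h'.isForm.map_smul 0 0
    simp_all
  | add X Y _ _ hX hY => rw [h.isForm.map_add, h'.isForm.map_add, hX, hY]
  | smul z X _ hX => rw [h.isForm.map_smul, h'.isForm.map_smul, hX]

theorem galois_unique (h : IsSymmetry ε σ φ) (h' : IsSymmetry δ τ φ) : ε = δ := by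
  have h1 := h.isForm.map_smul Complex.I (toMat (hesse 0))
  rw [h'.isForm.map_smul, h.map_hesse] at h1
  have h0 : toMat (hesse (σ 0)) ≠ 0 := by
    rw [← map_zero toMat]
    exact fun h => hesse_ne_zero _ (toMat_injective h)
  exact gal_ext (smul_left_injective ℂ h0 h1).symm

theorem action_unique (h : IsSymmetry ε σ φ) (h' : IsSymmetry δ τ φ) (x : Pt) : σ x = τ x :=
  hesse_injective _ _ (toMat_injective (by rw [← h.map_hesse, ← h'.map_hesse]))

end IsSymmetry

section Rigidity

variable {ε : Bool} {φ : Equiv.Perm (Matrix (Fin 3) (Fin 3) ℂ)}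

theorem trace_toMat_hesse (x : Pt) : (toMat (hesse x)).trace = 2 := by
  rw [trace_toMat, trace_hesse, map_ofNat]

theorem trace_toMat_heis {v : Pt} (hv : v ≠ 0) : (toMat (heis v)).trace = 0 := by
  rw [trace_toMat, trace_heis v hv, map_zero]

theorem exists_map_hesse_eq (hf : IsForm ε φ) (h : FixesDecomposition φ) (x : Pt) :
    ∃ y, φ (toMat (hesse x)) = toMat (hesse y) := by
  obtain ⟨i, hi⟩ := exists_m_eq_hesse x
  obtain ⟨j, n, hn⟩ := fixesDecomposition_iff.mp h i
  have ht := hf.trace (m i)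
  rw [hn, ← hi, trace_toMat_hesse, map_ofNat, Matrix.trace_smul, smul_eq_mul] at ht
  rcases m_cases j with ⟨y, hy⟩ | hj | ⟨v, hv, k, hk⟩
  · rw [hy, trace_toMat_hesse] at ht
    have h1 : ζ ^ n = 1 := mul_right_cancel₀ two_ne_zero (ht.trans (one_mul 2).symm)
    exact ⟨y, by rw [hi, hn, h1, one_smul, hy]⟩
  · exfalso
    rw [hj, Matrix.trace_smul, Matrix.trace_one, smul_eq_mul, Fintype.card_fin] at ht
    have h3 := congrArg (· ^ 3) ht
    simp only [mul_pow, a_pow_three] at h3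
    rw [← pow_mul, mul_comm n 3, pow_mul, zeta_pow_three, one_pow] at h3
    norm_num at h3
  · rw [hk, Matrix.trace_smul, trace_toMat_heis hv] at ht
    simp at ht

theorem exists_map_heis_eq (hf : IsForm ε φ) (h : FixesDecomposition φ) {v : Pt} (hv : v ≠ 0) :
    ∃ w, ∃ n : ℕ, φ (toMat (heis v)) = ζ ^ n • toMat (heis w) := by
  obtain ⟨i, k, hi⟩ := exists_m_eq_heis hv
  obtain ⟨j, n, hn⟩ := fixesDecomposition_iff.mp h i
  obtain ⟨k', hk'⟩ := exists_gal_zeta_pow ε k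
  have hφ : φ (toMat (heis v)) = ζ ^ (k' + n) • m j := by
    rw [hi, hf.map_smul, hn, hk', smul_smul, pow_add]
  have ht := hf.trace (toMat (heis v))
  rw [hφ, trace_toMat_heis hv, map_zero, Matrix.trace_smul, smul_eq_zero] at ht
  replace ht := ht.resolve_left (pow_ne_zero _ zeta_ne_zero)
  rcases m_cases j with ⟨y, hy⟩ | hj | ⟨w, -, l, hl⟩
  · rw [hy, trace_toMat_hesse] at ht
    exact absurd ht two_ne_zero
  · exfalso
    rw [hj, Matrix.trace_smul, Matrix.trace_one, smul_eq_mul, Fintype.card_fin] at ht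
    have ha : a = 0 := by simpa using ht
    have := a_pow_three
    rw [ha] at this
    norm_num at this
  · exact ⟨w, k' + n + l, by rw [hφ, hl, smul_smul, ← pow_add]⟩

theorem exists_translation (hf : IsForm ε φ) (h : FixesDecomposition φ) {σ : Pt → Pt}
    (hσ : ∀ x, φ (toMat (hesse x)) = toMat (hesse (σ x))) {v : Pt} (hv : v ≠ 0) :
    ∃ u, ∀ x, σ (x + v) = σ x + u := by
  obtain ⟨w, n, hw⟩ := exists_map_heis_eq hf h hv
  have hn := pow_ne_zero n zeta_ne_zero
  have hrel : ∀ x, toMat (heis v) * toMat (hesse x) = toMat (hesse (x + v)) * toMat (heis v) :=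
    fun x => by rw [← map_mul, (isClifford_heis v).mul_hesse, map_mul]
  rcases hf.map_mul with hm | hm
  · refine ⟨w, fun x => hesse_mul_heis_injective _ _ w (toMat_injective ?_)⟩
    have h1 := congrArg φ (hrel x)
    rw [hm, hm, hw, hσ, hσ, Matrix.smul_mul, Matrix.mul_smul] at h1
    rw [← (isClifford_heis w).mul_hesse, map_mul, map_mul]
    exact (smul_right_injective _ hn h1).symm
  · refine ⟨-w, fun x => eq_add_neg_of_add_eq ?_⟩
    refine hesse_mul_heis_injective _ _ w (toMat_injective ?_)
    have h1 := congrArg φ (hrel x)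
    rw [hm, hm, hw, hσ, hσ, Matrix.smul_mul, Matrix.mul_smul] at h1
    rw [← (isClifford_heis w).mul_hesse, map_mul, map_mul]
    exact (smul_right_injective _ hn h1).symm

theorem exists_aff (hf : IsForm ε φ) (h : FixesDecomposition φ) :
    ∃ q, Nondegenerate q ∧ IsSymmetry ε (aff q) φ := by
  choose σ hσ using exists_map_hesse_eq hf h
  obtain ⟨u, hu⟩ := exists_translation hf h hσ (v := (1, 0)) (by decide)
  obtain ⟨v, hv⟩ := exists_translation hf h hσ (v := (0, 1)) (by decide)
  have hu' : ∀ (n : ℕ) x, σ (x + n • (1, 0)) = σ x + n • u := fun n x => by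
    induction n with
    | zero => simp
    | succ n ih => rw [succ_nsmul, ← add_assoc, hu, ih, succ_nsmul, add_assoc]
  have hv' : ∀ (n : ℕ) x, σ (x + n • (0, 1)) = σ x + n • v := fun n x => by
    induction n with
    | zero => simp
    | succ n ih => rw [succ_nsmul, ← add_assoc, hv, ih, succ_nsmul, add_assoc]
  have hdec : ∀ x : Pt, x = 0 + (x.1 : ℕ) • (1, 0) + (x.2 : ℕ) • (0, 1) := by decide
  have haff : σ = aff (u, v, σ 0) := by
    funext x
    conv_lhs => rw [hdec x]
    rw [hv', hu', aff]
    abel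
  have hinj : Function.Injective σ := fun x y hxy => by
    refine hesse_injective _ _ (toMat_injective (φ.injective ?_))
    rw [hσ, hσ, hxy]
  exact ⟨(u, v, σ 0), nondegenerate_of_injective _ (haff ▸ hinj), hf, h, haff ▸ hσ⟩

end Rigidity

/-- The symmetry with given Galois type and given action on the points. -/
noncomputable def symmetry (p : Bool × {q // Nondegenerate q}) :
    Equiv.Perm (Matrix (Fin 3) (Fin 3) ℂ) :=
  (exists_isSymmetry p.2.2 p.1).choose

theorem isSymmetry_symmetry (p : Bool × {q // Nondegenerate q}) :
    IsSymmetry p.1 (aff p.2) (symmetry p) :=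
  (exists_isSymmetry p.2.2 p.1).choose_spec

theorem symmetry_injective : Function.Injective symmetry := fun p p' h => by
  have h1 := isSymmetry_symmetry p
  rw [h] at h1
  have h2 := isSymmetry_symmetry p'
  exact Prod.ext (h1.galois_unique h2) (Subtype.ext (aff_injective (h1.action_unique h2)))

theorem mem_range_symmetry_iff {φ : Equiv.Perm (Matrix (Fin 3) (Fin 3) ℂ)} :
    φ ∈ Set.range symmetry ↔ IsSemilinearSymmetryForm φ ∧ FixesDecomposition φ := by
  rw [isSemilinearSymmetryForm_iff]
  constructor
  · rintro ⟨p, rfl⟩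
    exact ⟨⟨_, (isSymmetry_symmetry p).isForm⟩, (isSymmetry_symmetry p).fixes⟩
  · rintro ⟨⟨ε, hf⟩, h⟩
    obtain ⟨q, hq, hs⟩ := exists_aff hf h
    exact ⟨(ε, ⟨q, hq⟩), (isSymmetry_symmetry (ε, ⟨q, hq⟩)).unique hs⟩

/-- The symmetries of the decomposition, as a submonoid. -/
noncomputable def symmetryMonoid : Submonoid (Equiv.Perm (Matrix (Fin 3) (Fin 3) ℂ)) where
  carrier := Set.range symmetry
  one_mem' := mem_range_symmetry_iff.mpr
    ⟨isSemilinearSymmetryForm_iff.mpr ⟨_, IsSymmetry.one.isForm⟩, IsSymmetry.one.fixes⟩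
  mul_mem' := by
    rintro _ _ ⟨p, rfl⟩ ⟨p', rfl⟩
    have h := (isSymmetry_symmetry p).mul (isSymmetry_symmetry p')
    exact mem_range_symmetry_iff.mpr ⟨isSemilinearSymmetryForm_iff.mpr ⟨_, h.isForm⟩, h.fixes⟩

theorem inv_mem_of_finite {G : Type*} [Group G] (K : Submonoid G) [Finite K] {x : G}
    (hx : x ∈ K) : x⁻¹ ∈ K := by
  obtain ⟨n, hn, h⟩ := (finite_powers.mp ((Set.toFinite (K : Set G)).subset
    (Submonoid.powers_le.mpr hx))).exists_pow_eq_one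
  have h2 : x⁻¹ = x ^ (n - 1) := by
    rw [inv_eq_iff_mul_eq_one, ← pow_succ', Nat.sub_add_cancel hn, h]
  exact h2 ▸ K.pow_mem hx _

/-- The symmetries of the decomposition form a group. -/
noncomputable def symmetryGroup : Subgroup (Equiv.Perm (Matrix (Fin 3) (Fin 3) ℂ)) :=
  { symmetryMonoid with
    inv_mem' := fun {_} hx =>
      haveI : Finite symmetryMonoid := Set.finite_range symmetry
      inv_mem_of_finite symmetryMonoid hx }

theorem card_symmetryGroup : Nat.card symmetryGroup = 864 := by
  have h : Nat.card symmetryGroup = Nat.card (Bool × {q // Nondegenerate q}) :=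
    Nat.card_range_of_injective symmetry_injective
  rw [h, Nat.card_prod, Nat.card_eq_fintype_card, Nat.card_eq_fintype_card, Fintype.card_bool,
    card_nondegenerate]

end Hesse

/-- Including the Galois symmetry of complex conjugation, the symmetries of the
decomposition form a group of order 864 under composition. -/
theorem symmetry_group_with_conjugation_order_864 :
    ∃ H : Subgroup (Equiv.Perm (Matrix (Fin 3) (Fin 3) ℂ)),
      (∀ φ, φ ∈ H ↔ (IsSemilinearSymmetryForm φ ∧ FixesDecomposition φ)) ∧
      Nat.card H = 864 := by
  exact ⟨Hesse.symmetryGroup, fun _ => Hesse.mem_range_symmetry_iff, Hesse.card_symmetryGroup⟩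
end
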